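/- Fix 1 ≤ k ≤ s < r and set x_Q = e₁ + ⋯ + e_k. Let w ∈ W_M satisfy the minimality condition that w(β) ∈ R⁺ for every β ∈ R_M⁺ with ⟨β, x_Q⟩ = 0. Define χ^M = Σ β over all β ∈ R_M⁺ with ⟨β, x_Q⟩ ≠ 0 and w(β) ∈ R⁺, and χ^H = Σ β over all β ∈ R_H⁺ with ⟨β, x_Q⟩ ≠ 0 and w(β) ∈ R_H⁺. Then χ^M − χ^H = ½(ε^L + w⁻¹(ε)), where ε = e₁ + ⋯ + e_s and ε^L = (e₁ + ⋯ + e_k) − (e_{k+1} + ⋯ + e_s). -/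

import Mathlib

/-- The standard inner product on `ℝ^n`. -/
def ip {n : ℕ} (v w : Fin n → ℝ) : ℝ := ∑ i, v i * w i

/-- The orthogonal reflection `v ↦ v − (2⟨v,β⟩/⟨β,β⟩)β` with respect to a vector `β`. -/
noncomputable def reflFun {n : ℕ} (β : Fin n → ℝ) : (Fin n → ℝ) → (Fin n → ℝ) :=
  fun v => v - (2 * ip v β / ip β β) • β

lemma ip_sub_smul {n : ℕ} (v β : Fin n → ℝ) (c : ℝ) :
    ip (v - c • β) β = ip v β - c * ip β β := by
  simp only [ip, Pi.sub_apply, Pi.smul_apply, smul_eq_mul, sub_mul,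
    Finset.sum_sub_distrib, Finset.mul_sum, mul_assoc]

lemma reflFun_involutive {n : ℕ} (β : Fin n → ℝ) : Function.Involutive (reflFun β) := by
  intro v
  by_cases h : ip β β = 0
  · simp [reflFun, h]
  · simp only [reflFun]
    rw [ip_sub_smul, sub_sub, ← add_smul]
    have hc : 2 * ip v β / ip β β + 2 * (ip v β - 2 * ip v β / ip β β * ip β β) / ip β β = 0 := by
      field_simp
      ring
    rw [hc, zero_smul, sub_zero]

/-- The orthogonal reflection with respect to `β`, as a permutation of `ℝ^n`. -/
noncomputable def reflPerm {n : ℕ} (β : Fin n → ℝ) : Equiv.Perm (Fin n → ℝ) :=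
  Function.Involutive.toPerm (reflFun β) (reflFun_involutive β)

/-- The standard basis vector `e_i` of `ℝ^r` (1-based index). -/
def sv (r i : ℕ) : Fin r → ℝ := fun j => if (j : ℕ) + 1 = i then 1 else 0

/-- The simple roots of `Sp(2r)`: `α_i = e_i − e_{i+1}` for `1 ≤ i ≤ r−1`, `α_r = 2e_r`. -/
def sroot (r i : ℕ) : Fin r → ℝ := if i = r then (2 : ℝ) • sv r r else sv r i - sv r (i + 1)

/-- The positive roots of `Sp(2r)`. -/
def Rpos (r : ℕ) : Set (Fin r → ℝ) :=
  {β | ∃ i j, 1 ≤ i ∧ i < j ∧ j ≤ r ∧ (β = sv r i - sv r j ∨ β = sv r i + sv r j)} ∪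
  {β | ∃ i, 1 ≤ i ∧ i ≤ r ∧ β = (2 : ℝ) • sv r i}

/-- The positive roots of the subgroup `M = Sp(2s) × Sp(2(r−s))` of `Sp(2r)`. -/
def RMpos (r s : ℕ) : Set (Fin r → ℝ) :=
  {β | ∃ i j, 1 ≤ i ∧ i < j ∧ j ≤ s ∧ (β = sv r i - sv r j ∨ β = sv r i + sv r j)} ∪
  {β | ∃ i, 1 ≤ i ∧ i ≤ s ∧ β = (2 : ℝ) • sv r i} ∪
  {β | ∃ i j, s < i ∧ i < j ∧ j ≤ r ∧ (β = sv r i - sv r j ∨ β = sv r i + sv r j)} ∪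
  {β | ∃ i, s < i ∧ i ≤ r ∧ β = (2 : ℝ) • sv r i}

/-- The positive roots of `H = SO(2s+1) × Sp(2(r−s))`. -/
def RHpos (r s : ℕ) : Set (Fin r → ℝ) :=
  {β | ∃ i j, 1 ≤ i ∧ i < j ∧ j ≤ s ∧ (β = sv r i - sv r j ∨ β = sv r i + sv r j)} ∪
  {β | ∃ i, 1 ≤ i ∧ i ≤ s ∧ β = sv r i} ∪
  {β | ∃ i j, s < i ∧ i < j ∧ j ≤ r ∧ (β = sv r i - sv r j ∨ β = sv r i + sv r j)} ∪
  {β | ∃ i, s < i ∧ i ≤ r ∧ β = (2 : ℝ) • sv r i}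

lemma perm_apply_inv {α : Type*} (f : Equiv.Perm α) (x : α) : f (f⁻¹ x) = x :=
  f.apply_symm_apply x

lemma sv_apply' (r i : ℕ) (j : Fin r) : sv r i j = if (j : ℕ) + 1 = i then 1 else 0 := rfl

lemma sum_mul_sv {r : ℕ} (v : Fin r → ℝ) (a : Fin r) :
    ∑ i, v i * sv r ((a : ℕ) + 1) i = v a := by
  rw [Finset.sum_eq_single a]
  · simp [sv]
  · intro b _ hb
    have : (b : ℕ) ≠ a := fun h => hb (Fin.ext h)
    simp [sv, this]
  · simp

lemma ip_sv_right {r : ℕ} (v : Fin r → ℝ) (a : Fin r) : ip v (sv r ((a : ℕ) + 1)) = v a :=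
  sum_mul_sv v a

lemma ip_sv_right' {r : ℕ} (v : Fin r → ℝ) (i : ℕ) (h1 : 1 ≤ i) (h2 : i ≤ r) :
    ip v (sv r i) = v ⟨i - 1, by omega⟩ := by
  have := ip_sv_right v ⟨i - 1, by omega⟩
  simpa [Nat.sub_add_cancel h1] using this

lemma ip_add_right' {r : ℕ} (v a b : Fin r → ℝ) : ip v (a + b) = ip v a + ip v b := by
  simp [ip, mul_add, Finset.sum_add_distrib]

lemma ip_sub_right' {r : ℕ} (v a b : Fin r → ℝ) : ip v (a - b) = ip v a - ip v b := by
  simp [ip, mul_sub, Finset.sum_sub_distrib]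

lemma ip_smul_right' {r : ℕ} (v a : Fin r → ℝ) (c : ℝ) : ip v (c • a) = c * ip v a := by
  simp only [ip, Pi.smul_apply, smul_eq_mul, Finset.mul_sum]
  exact Finset.sum_congr rfl fun _ _ => by ring

lemma ip_comm' {r : ℕ} (v a : Fin r → ℝ) : ip v a = ip a v := by
  simp [ip, mul_comm]

/-- Signed permutations preserving the blocks. -/
def SP (r s : ℕ) (w : Equiv.Perm (Fin r → ℝ)) : Prop :=
  ∃ (σ : Equiv.Perm (Fin r)) (e : Fin r → ℝ), (∀ i, e i = 1 ∨ e i = -1) ∧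
    (∀ i, ((σ i : Fin r) : ℕ) < s ↔ (i : ℕ) < s) ∧ ∀ v i, w v (σ i) = e i * v i

lemma ip_pm {r i j : ℕ} (h1 : 1 ≤ i) (hij : i < j) (hj : j ≤ r) {β : Fin r → ℝ}
    (h : β = sv r i - sv r j ∨ β = sv r i + sv r j) : ip β β = 2 := by
  have e1 : ¬ (j - 1 + 1 = i) := by omega
  have e2 : ¬ (i - 1 + 1 = j) := by omega
  have e3 : (j - 1 + 1 = j) := by omega
  have e4 : (i - 1 + 1 = i) := by omega
  rcases h with rfl | rfl
  · rw [ip_sub_right', ip_sv_right' _ i h1 (by omega), ip_sv_right' _ j (by omega) hj]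
    simp [sv_apply', e3, e4, hij.ne, hij.ne']; norm_num
  · rw [ip_add_right', ip_sv_right' _ i h1 (by omega), ip_sv_right' _ j (by omega) hj]
    simp [sv_apply', e3, e4, hij.ne, hij.ne']; norm_num

lemma ip_long {r i : ℕ} (h1 : 1 ≤ i) (hj : i ≤ r) : ip (sv r i) (sv r i) = 1 := by
  rw [ip_sv_right' _ i h1 hj]; simp [sv_apply']; omega

lemma ip_long2 {r i : ℕ} (h1 : 1 ≤ i) (hj : i ≤ r) :
    ip ((2 : ℝ) • sv r i) ((2 : ℝ) • sv r i) = 4 := by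
  rw [ip_smul_right', ip_comm', ip_smul_right', ip_long h1 hj]; norm_num

lemma SP_pm {r s i j : ℕ} (h1 : 1 ≤ i) (hij : i < j) (hj : j ≤ r) (hs : j ≤ s ∨ s < i)
    {β : Fin r → ℝ} (h : β = sv r i - sv r j ∨ β = sv r i + sv r j) : SP r s (reflPerm β) := by
  have h2 := ip_pm h1 hij hj h
  have hi : i - 1 < r := by omega
  have hj' : j - 1 < r := by omega
  have hblock : ∀ l : Fin r, ((Equiv.swap (⟨i - 1, hi⟩ : Fin r) ⟨j - 1, hj'⟩ l : Fin r) : ℕ) < s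
      ↔ (l : ℕ) < s := by
    intro l
    rw [Equiv.swap_apply_def]
    split_ifs with ha hb
    · subst ha; simp only; omega
    · subst hb; simp only; omega
    · rfl
  rcases h with h | h
  · refine ⟨Equiv.swap ⟨i - 1, hi⟩ ⟨j - 1, hj'⟩, fun _ => 1, fun _ => Or.inl rfl, hblock, ?_⟩
    intro v l
    change (v - (2 * ip v β / ip β β) • β) _ = _
    have h3 : ip v β = v ⟨i - 1, hi⟩ - v ⟨j - 1, hj'⟩ := by
      rw [h, ip_sub_right', ip_sv_right' _ i h1 (by omega), ip_sv_right' _ j (by omega) hj]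
    rw [h2, h3, Equiv.swap_apply_def]
    split_ifs with ha hb
    · subst ha
      have e1 : ¬ (j - 1 + 1 = i) := by omega
      have e3 : (j - 1 + 1 = j) := by omega
      simp [h, sv_apply', e3, hij.ne, hij.ne']
    · subst hb
      have e1 : ¬ (i - 1 + 1 = j) := by omega
      have e3 : (i - 1 + 1 = i) := by omega
      simp [h, sv_apply', e3, hij.ne, hij.ne']
    · have e1 : ¬ ((l : ℕ) + 1 = i) := fun hh => ha (Fin.ext (by simp only; omega))
      have e3 : ¬ ((l : ℕ) + 1 = j) := fun hh => hb (Fin.ext (by simp only; omega))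
      simp [h, sv_apply', e1, e3]
  · refine ⟨Equiv.swap ⟨i - 1, hi⟩ ⟨j - 1, hj'⟩,
      fun l => if l = ⟨i - 1, hi⟩ ∨ l = ⟨j - 1, hj'⟩ then -1 else 1,
      fun l => by by_cases hl : l = ⟨i - 1, hi⟩ ∨ l = ⟨j - 1, hj'⟩ <;> simp [hl], hblock, ?_⟩
    intro v l
    change (v - (2 * ip v β / ip β β) • β) _ = _
    have h3 : ip v β = v ⟨i - 1, hi⟩ + v ⟨j - 1, hj'⟩ := by
      rw [h, ip_add_right', ip_sv_right' _ i h1 (by omega), ip_sv_right' _ j (by omega) hj]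
    rw [h2, h3, Equiv.swap_apply_def]
    by_cases ha : l = ⟨i - 1, hi⟩
    · subst ha
      have e1 : ¬ (j - 1 + 1 = i) := by omega
      have e3 : (j - 1 + 1 = j) := by omega
      simp [h, sv_apply', e3, hij.ne, hij.ne']
    · by_cases hb : l = ⟨j - 1, hj'⟩
      · subst hb
        have e1 : ¬ (i - 1 + 1 = j) := by omega
        have e3 : (i - 1 + 1 = i) := by omega
        rw [if_neg ha]
        simp [h, sv_apply', e3, hij.ne, hij.ne']
      · have e1 : ¬ ((l : ℕ) + 1 = i) := fun hh => ha (Fin.ext (by simp only; omega))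
        have e3 : ¬ ((l : ℕ) + 1 = j) := fun hh => hb (Fin.ext (by simp only; omega))
        simp [h, sv_apply', e1, e3, ha, hb]

lemma SP_long {r s i : ℕ} (h1 : 1 ≤ i) (hj : i ≤ r) : SP r s (reflPerm ((2 : ℝ) • sv r i)) := by
  have hi : i - 1 < r := by omega
  refine ⟨1, fun l => if l = ⟨i - 1, hi⟩ then -1 else 1,
    fun l => by by_cases hl : l = ⟨i - 1, hi⟩ <;> simp [hl], fun _ => Iff.rfl, ?_⟩
  intro v l
  change (v - (2 * ip v ((2 : ℝ) • sv r i) / ip ((2 : ℝ) • sv r i) ((2 : ℝ) • sv r i))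
    • ((2 : ℝ) • sv r i)) l = _
  rw [ip_long2 h1 hj, ip_smul_right', ip_sv_right' _ i h1 hj]
  by_cases ha : l = ⟨i - 1, hi⟩
  · subst ha
    have e3 : (i - 1 + 1 = i) := by omega
    simp [sv_apply', e3]; ring
  · have e1 : ¬ ((l : ℕ) + 1 = i) := fun hh => ha (Fin.ext (by simp only; omega))
    simp [sv_apply', e1, ha]

lemma SP_of_mem {r s : ℕ} (hsr : s < r) {w : Equiv.Perm (Fin r → ℝ)}
    (hw : w ∈ Subgroup.closure ((fun β => reflPerm β) '' RMpos r s)) : SP r s w := by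
  induction hw using Subgroup.closure_induction with
  | mem x hx =>
    obtain ⟨β, hβ, rfl⟩ := hx
    rcases hβ with ((⟨i, j, h1, h2, h3, h⟩ | ⟨i, h1, h2, rfl⟩) | ⟨i, j, h1, h2, h3, h⟩) |
      ⟨i, h1, h2, rfl⟩
    · exact SP_pm h1 h2 (by omega) (by omega) h
    · exact SP_long h1 (by omega)
    · exact SP_pm (by omega) h2 (by omega) (by omega) h
    · exact SP_long (by omega) (by omega)
  | one => exact ⟨1, fun _ => 1, fun _ => Or.inl rfl, fun _ => Iff.rfl, fun v i => by simp⟩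
  | mul x y _ _ hx hy =>
    obtain ⟨σ, e, he, hb, hx⟩ := hx
    obtain ⟨τ, f, hf, hc, hy⟩ := hy
    refine ⟨σ * τ, fun i => e (τ i) * f i, ?_, ?_, ?_⟩
    · intro i
      rcases he (τ i) with h | h <;> rcases hf i with h' | h' <;> simp [h, h']
    · intro i
      rw [Equiv.Perm.mul_apply, hb, hc]
    · intro v i
      rw [Equiv.Perm.mul_apply, Equiv.Perm.mul_apply, hx, hy, mul_assoc]
  | inv x _ hx =>
    obtain ⟨σ, e, he, hb, hx⟩ := hx
    refine ⟨σ⁻¹, fun i => e (σ⁻¹ i), fun i => he _, ?_, ?_⟩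
    · intro i
      rw [← hb, perm_apply_inv]
    · intro v i
      have := hx (x⁻¹ v) (σ⁻¹ i)
      rw [perm_apply_inv, perm_apply_inv] at this
      rw [this, ← mul_assoc]
      rcases he (σ⁻¹ i) with h | h <;> (simp only [h]; ring)

/-- Short roots of the first block. -/
def Sh (r s : ℕ) : Set (Fin r → ℝ) :=
  {β | ∃ i j, 1 ≤ i ∧ i < j ∧ j ≤ s ∧ (β = sv r i - sv r j ∨ β = sv r i + sv r j)}

lemma Sh_finite (r s : ℕ) : (Sh r s).Finite := by
  apply ((((Finset.range (s+1) ×ˢ Finset.range (s+1)).image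
    (fun p => sv r p.1 - sv r p.2)) ∪ ((Finset.range (s+1) ×ˢ Finset.range (s+1)).image
    (fun p => sv r p.1 + sv r p.2))).finite_toSet).subset
  rintro β ⟨i, j, h1, h2, h3, rfl | rfl⟩
  · simp only [Finset.coe_union, Set.mem_union, Finset.mem_coe, Finset.mem_image]
    left; exact ⟨(i, j), by simp; omega, rfl⟩
  · simp only [Finset.coe_union, Set.mem_union, Finset.mem_coe, Finset.mem_image]
    right; exact ⟨(i, j), by simp; omega, rfl⟩

lemma pm_zero {r s i j : ℕ} (h1 : 1 ≤ i) (hij : i < j) (hj : j ≤ r) {β : Fin r → ℝ}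
    (h : β = sv r i - sv r j ∨ β = sv r i + sv r j)
    (hz : ∀ l : Fin r, s ≤ (l : ℕ) → β l = 0) : j ≤ s := by
  by_contra hc
  have := hz ⟨j - 1, by omega⟩ (by simp only; omega)
  have e1 : ¬ (j - 1 + 1 = i) := by omega
  have e3 : (j - 1 + 1 = j) := by omega
  rcases h with rfl | rfl <;> norm_num [sv_apply', e3, hij.ne'] at this

lemma pm_pos {r i j : ℕ} (h1 : 1 ≤ i) (hij : i < j) (hj : j ≤ r) {β : Fin r → ℝ}
    (h : β = sv r i - sv r j ∨ β = sv r i + sv r j) : ∃ l, 0 < β l := by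
  refine ⟨⟨i - 1, by omega⟩, ?_⟩
  have e1 : ¬ (i - 1 + 1 = j) := by omega
  have e3 : (i - 1 + 1 = i) := by omega
  rcases h with rfl | rfl <;> simp [sv_apply', e3, hij.ne]

lemma sv_pos {r i : ℕ} (h1 : 1 ≤ i) (hj : i ≤ r) : ∃ l, 0 < sv r i l := by
  refine ⟨⟨i - 1, by omega⟩, ?_⟩
  have e3 : (i - 1 + 1 = i) := by omega
  simp [sv_apply', e3]

lemma sv_pos2 {r i : ℕ} (h1 : 1 ≤ i) (hj : i ≤ r) : ∃ l, 0 < ((2 : ℝ) • sv r i) l := by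
  obtain ⟨l, hl⟩ := sv_pos h1 hj
  exact ⟨l, by simpa using hl⟩

lemma Rpos_pos {r : ℕ} {β : Fin r → ℝ} (h : β ∈ Rpos r) : ∃ l, 0 < β l := by
  rcases h with ⟨i, j, h1, h2, h3, h⟩ | ⟨i, h1, h2, rfl⟩
  · exact pm_pos h1 h2 h3 h
  · exact sv_pos2 h1 h2

lemma RHpos_pos {r s : ℕ} (hsr : s < r) {β : Fin r → ℝ} (h : β ∈ RHpos r s) : ∃ l, 0 < β l := by
  rcases h with ((⟨i, j, h1, h2, h3, h⟩ | ⟨i, h1, h2, rfl⟩) | ⟨i, j, h1, h2, h3, h⟩) |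
      ⟨i, h1, h2, rfl⟩
  · exact pm_pos h1 h2 (by omega) h
  · exact sv_pos h1 (by omega)
  · exact pm_pos (by omega) h2 (by omega) h
  · exact sv_pos2 (by omega) (by omega)

lemma Rpos_iff {r s : ℕ} (hsr : s < r) {β : Fin r → ℝ} (h2 : ip β β = 2)
    (hz : ∀ l : Fin r, s ≤ (l : ℕ) → β l = 0) : β ∈ Rpos r ↔ β ∈ RHpos r s := by
  constructor
  · rintro (⟨i, j, h1, h2, h3, h⟩ | ⟨i, h1, h3, rfl⟩)
    · exact Or.inl (Or.inl (Or.inl ⟨i, j, h1, h2, pm_zero h1 h2 h3 h hz, h⟩))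
    · rw [ip_long2 h1 h3] at h2; norm_num at h2
  · rintro (((⟨i, j, h1, h2, h3, h⟩ | ⟨i, h1, h3, rfl⟩) | ⟨i, j, h1, h2, h3, h⟩) |
      ⟨i, h1, h3, rfl⟩)
    · exact Or.inl ⟨i, j, h1, h2, by omega, h⟩
    · rw [ip_long h1 (by omega)] at h2; norm_num at h2
    · exact Or.inl ⟨i, j, by omega, h2, by omega, h⟩
    · rw [ip_long2 (by omega) h3] at h2; norm_num at h2

lemma sum_sv_apply {r : ℕ} (a b : ℕ) (l : Fin r) :
    (∑ i ∈ Finset.Icc a b, sv r i) l = if a ≤ (l : ℕ) + 1 ∧ (l : ℕ) + 1 ≤ b then 1 else 0 := by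
  simp [Finset.sum_apply, sv_apply']

lemma ip_pm_xQ_zero {r s k i : ℕ} (h : s < i) (hks : k ≤ s) (hi : i ≤ r) :
    ip (sv r i) (∑ l ∈ Finset.Icc 1 k, sv r l) = 0 := by
  rw [ip_comm', ip_sv_right' _ i (by omega) hi, sum_sv_apply, if_neg]
  simp only; omega

lemma ip_xQ {r k : ℕ} (l : Fin r) : ip (sv r ((l : ℕ) + 1)) (∑ l ∈ Finset.Icc 1 k, sv r l)
    = if (l : ℕ) < k then 1 else 0 := by
  rw [ip_comm', ip_sv_right, sum_sv_apply]
  simp [Nat.succ_le_iff]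

lemma ip_pm_xQ_zero' {r s k i j : ℕ} (h : s < i) (hks : k ≤ s) (hij : i < j) (hj : j ≤ r)
    {β : Fin r → ℝ} (hβ : β = sv r i - sv r j ∨ β = sv r i + sv r j) :
    ip β (∑ l ∈ Finset.Icc 1 k, sv r l) = 0 := by
  have h1 := ip_pm_xQ_zero (r := r) h hks (by omega)
  have h2 := ip_pm_xQ_zero (r := r) (h.trans hij) hks hj
  rw [ip_comm'] at h1 h2 ⊢
  rcases hβ with rfl | rfl
  · rw [ip_sub_right', h1, h2, sub_zero]
  · rw [ip_add_right', h1, h2, add_zero]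

lemma sv_inj {r : ℕ} (c : ℝ) (hc : c ≠ 0) :
    Function.Injective (fun l : Fin r => c • sv r ((l : ℕ) + 1)) := by
  intro a b h
  have := congrFun h a
  simp only [Pi.smul_apply, sv_apply', smul_eq_mul] at this
  by_contra hab
  have h' : ¬ ((a : ℕ) + 1 = b + 1) := fun hh => hab (Fin.ext (by omega))
  rw [if_neg h'] at this
  simp [hc] at this

/--
Fix `1 ≤ k ≤ s < r`, set `x_Q = e₁ + ⋯ + e_k`.  Let `w ∈ W_M` satisfy the minimality
condition that `w(β) ∈ R⁺` for every `β ∈ R_M⁺` with `⟨β, x_Q⟩ = 0`.  Then, with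
`χ^M = Σ {β ∈ R_M⁺ : ⟨β, x_Q⟩ ≠ 0, w(β) ∈ R⁺}` and
`χ^H = Σ {β ∈ R_H⁺ : ⟨β, x_Q⟩ ≠ 0, w(β) ∈ R_H⁺}`, we have
`χ^M − χ^H = ½(ε^L + w⁻¹(ε))` where `ε = e₁ + ⋯ + e_s` and
`ε^L = (e₁ + ⋯ + e_k) − (e_{k+1} + ⋯ + e_s)`.
-/
theorem chiM_sub_chiH
    (r s k : ℕ) (hk : 1 ≤ k) (hks : k ≤ s) (hsr : s < r)
    (w : Equiv.Perm (Fin r → ℝ))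
    (hw : w ∈ Subgroup.closure ((fun β => reflPerm β) '' RMpos r s))
    (hmin : ∀ β ∈ RMpos r s, ip β (∑ l ∈ Finset.Icc 1 k, sv r l) = 0 → w β ∈ Rpos r) :
    let xQ : Fin r → ℝ := ∑ l ∈ Finset.Icc 1 k, sv r l
    let ε : Fin r → ℝ := ∑ l ∈ Finset.Icc 1 s, sv r l
    let εL : Fin r → ℝ :=
      (∑ l ∈ Finset.Icc 1 k, sv r l) - ∑ l ∈ Finset.Icc (k + 1) s, sv r l
    (∑ᶠ β ∈ {β ∈ RMpos r s | ip β xQ ≠ 0 ∧ w β ∈ Rpos r}, β)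
      - (∑ᶠ β ∈ {β ∈ RHpos r s | ip β xQ ≠ 0 ∧ w β ∈ RHpos r s}, β)
      = (1 / 2 : ℝ) • (εL + w⁻¹ ε) := by
  intro xQ ε εL
  obtain ⟨σ, e, he, hb, hwv⟩ := SP_of_mem hsr hw
  have hipw : ∀ v, ip (w v) (w v) = ip v v := by
    intro v
    unfold ip
    rw [← Equiv.sum_comp σ]
    refine Finset.sum_congr rfl fun i _ => ?_
    rw [hwv]
    rcases he i with h | h <;> simp [h]
  have hneg : ∀ (c : ℝ) (l : Fin r), 0 < c → e l = -1 →
      ¬ ∃ m, 0 < w (c • sv r ((l : ℕ) + 1)) m := by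
    rintro c l hc hl ⟨m, hm⟩
    obtain ⟨m, rfl⟩ := σ.surjective m
    rw [hwv] at hm
    simp only [Pi.smul_apply, sv_apply', smul_eq_mul] at hm
    split_ifs at hm with h
    · have : m = l := Fin.ext (by omega)
      rw [this, hl] at hm; linarith
    · simp at hm
  have hpos : ∀ (c : ℝ) (l : Fin r), e l = 1 →
      w (c • sv r ((l : ℕ) + 1)) = c • sv r (((σ l : Fin r) : ℕ) + 1) := by
    intro c l hl
    funext m
    obtain ⟨m, rfl⟩ := σ.surjective m
    rw [hwv]
    simp only [Pi.smul_apply, sv_apply', smul_eq_mul]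
    by_cases h : m = l
    · subst h; simp [hl]
    · have h1 : ¬ ((m : ℕ) + 1 = l + 1) := fun hh => h (Fin.ext (by omega))
      have h2 : ¬ (((σ m : Fin r) : ℕ) + 1 = (σ l : Fin r) + 1) :=
        fun hh => h (σ.injective (Fin.ext (by omega)))
      rw [if_neg h1, if_neg h2]; simp
  -- signs beyond k
  have hek : ∀ l : Fin r, k ≤ (l : ℕ) → (l : ℕ) < s → e l = 1 := by
    intro l h1 h2
    rcases he l with h | h
    · exact h
    · exfalso
      refine hneg 2 l two_pos h (Rpos_pos (hmin _ ?_ ?_))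
      · exact Or.inl (Or.inl (Or.inr ⟨l + 1, by omega, by omega, rfl⟩))
      · rw [ip_comm', ip_smul_right', ip_comm', ip_xQ, if_neg (by omega), mul_zero]
  let T : Finset (Fin r) := Finset.univ.filter (fun l => (l : ℕ) < k ∧ e l = 1)
  let A : Set (Fin r → ℝ) := {β ∈ Sh r s | ip β xQ ≠ 0 ∧ w β ∈ Rpos r}
  have hA2 : ∀ β ∈ Sh r s, ip β β = 2 := by
    rintro β ⟨i, j, h1, h2, h3, h⟩
    exact ip_pm h1 h2 (by omega) h
  have hiff : ∀ β ∈ Sh r s, (w β ∈ Rpos r ↔ w β ∈ RHpos r s) := by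
    intro β hβ
    refine Rpos_iff hsr (by rw [hipw, hA2 β hβ]) ?_
    intro l hl
    obtain ⟨l, rfl⟩ := σ.surjective l
    have hl' : ¬ ((l : ℕ) < s) := by rw [← hb]; omega
    rw [hwv]
    obtain ⟨i, j, h1, h2, h3, h⟩ := hβ
    have e1 : ¬ ((l : ℕ) + 1 = i) := by omega
    have e2 : ¬ ((l : ℕ) + 1 = j) := by omega
    rcases h with rfl | rfl <;> simp [sv_apply', e1, e2]
  have hAfin : A.Finite := (Sh_finite r s).subset fun β hβ => hβ.1
  have hM : {β ∈ RMpos r s | ip β xQ ≠ 0 ∧ w β ∈ Rpos r}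
      = A ∪ (fun l : Fin r => (2 : ℝ) • sv r ((l : ℕ) + 1)) '' (T : Set (Fin r)) := by
    ext β
    constructor
    · rintro ⟨(((h | ⟨i, h1, h2, rfl⟩) | ⟨i, j, h1, h2, h3, h⟩) | ⟨i, h1, h2, rfl⟩), hne, hp⟩
      · exact Or.inl ⟨h, hne, hp⟩
      · right
        obtain ⟨l, rfl⟩ : ∃ l : Fin r, i = (l : ℕ) + 1 := ⟨⟨i - 1, by omega⟩, by simp only; omega⟩
        rw [ip_comm', ip_smul_right', ip_comm', ip_xQ] at hne
        refine ⟨l, ?_, rfl⟩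
        simp only [T, Finset.coe_filter, Finset.mem_univ, true_and, Set.mem_ofPred_eq]
        refine ⟨by by_contra hc; simp [hc] at hne, ?_⟩
        rcases he l with h | h
        · exact h
        · exact absurd (Rpos_pos hp) (hneg 2 l two_pos h)
      · exact absurd (ip_pm_xQ_zero' h1 hks h2 h3 h) hne
      · rw [ip_comm', ip_smul_right', ip_comm', ip_pm_xQ_zero h1 hks h2] at hne
        simp at hne
    · rintro (⟨h, hne, hp⟩ | ⟨l, hl, rfl⟩)
      · exact ⟨Or.inl (Or.inl (Or.inl h)), hne, hp⟩
      · simp only [T, Finset.coe_filter, Finset.mem_univ, true_and, Set.mem_ofPred_eq] at hl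
        refine ⟨Or.inl (Or.inl (Or.inr ⟨l + 1, by omega, by omega, rfl⟩)), ?_, ?_⟩
        · rw [ip_comm', ip_smul_right', ip_comm', ip_xQ, if_pos hl.1]; norm_num
        · simp only [hpos 2 l hl.2]
          exact Or.inr ⟨_, by omega, (σ l).2, rfl⟩
  have hH : {β ∈ RHpos r s | ip β xQ ≠ 0 ∧ w β ∈ RHpos r s}
      = A ∪ (fun l : Fin r => (1 : ℝ) • sv r ((l : ℕ) + 1)) '' (T : Set (Fin r)) := by
    ext β
    constructor
    · rintro ⟨(((h | ⟨i, h1, h2, rfl⟩) | ⟨i, j, h1, h2, h3, h⟩) | ⟨i, h1, h2, rfl⟩), hne, hp⟩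
      · exact Or.inl ⟨h, hne, (hiff β h).2 hp⟩
      · right
        obtain ⟨l, rfl⟩ : ∃ l : Fin r, i = (l : ℕ) + 1 := ⟨⟨i - 1, by omega⟩, by simp only; omega⟩
        rw [ip_xQ] at hne
        refine ⟨l, ?_, one_smul _ _⟩
        simp only [T, Finset.coe_filter, Finset.mem_univ, true_and, Set.mem_ofPred_eq]
        refine ⟨by by_contra hc; simp [hc] at hne, ?_⟩
        rcases he l with h | h
        · exact h
        · have := hneg 1 l one_pos h
          rw [one_smul] at this
          exact absurd (RHpos_pos hsr hp) this
      · exact absurd (ip_pm_xQ_zero' h1 hks h2 h3 h) hne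
      · rw [ip_comm', ip_smul_right', ip_comm', ip_pm_xQ_zero h1 hks h2] at hne
        simp at hne
    · rintro (⟨h, hne, hp⟩ | ⟨l, hl, rfl⟩)
      · exact ⟨Or.inl (Or.inl (Or.inl h)), hne, (hiff β h).1 hp⟩
      · simp only [T, Finset.coe_filter, Finset.mem_univ, true_and, Set.mem_ofPred_eq] at hl
        have hs := (hb l).2 (by omega)
        refine ⟨Or.inl (Or.inl (Or.inr ⟨l + 1, by omega, by omega, one_smul _ _⟩)), ?_, ?_⟩
        · simp only [one_smul]
          rw [ip_xQ, if_pos hl.1]; norm_num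
        · simp only [hpos 1 l hl.2]
          exact Or.inl (Or.inl (Or.inr ⟨_, by omega, hs, one_smul _ _⟩))
  have hsum : ∀ c : ℝ, (c = 1 ∨ c = 2) →
      ∑ᶠ β ∈ A ∪ (fun l : Fin r => c • sv r ((l : ℕ) + 1)) '' (T : Set (Fin r)), β
      = (∑ᶠ β ∈ A, β) + ∑ l ∈ T, c • sv r ((l : ℕ) + 1) := by
    intro c hc
    have hc0 : c ≠ 0 := by rcases hc with rfl | rfl <;> norm_num
    rw [finsum_mem_union ?_ hAfin (T.finite_toSet.image _),
      finsum_mem_image ((sv_inj c hc0).injOn), finsum_mem_coe_finset]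
    rw [Set.disjoint_left]
    rintro β hβ ⟨l, -, rfl⟩
    have h2 := hA2 _ hβ.1
    simp only at h2
    rw [ip_smul_right', ip_comm', ip_smul_right', ip_long (by omega) (by omega)] at h2
    rcases hc with rfl | rfl <;> norm_num at h2
  rw [hM, hH, hsum 2 (Or.inr rfl), hsum 1 (Or.inl rfl), add_sub_add_left_eq_sub,
    ← Finset.sum_sub_distrib]
  funext l
  have hε : (w⁻¹ ε) l = e l * if (l : ℕ) < s then 1 else 0 := by
    have h := hwv (w⁻¹ ε) l
    rw [perm_apply_inv] at h
    have h2 : ε (σ l) = if (l : ℕ) < s then 1 else 0 := by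
      simp only [ε]
      rw [sum_sv_apply]
      simp [Nat.succ_le_iff, hb]
    rw [← h2, h]
    rcases he l with h | h <;> simp [h]
  have hL : (∑ m ∈ T, ((2 : ℝ) • sv r ((m : ℕ) + 1) - (1 : ℝ) • sv r ((m : ℕ) + 1))) l
      = if (l : ℕ) < k ∧ e l = 1 then 1 else 0 := by
    have : ∀ m : Fin r, ((2 : ℝ) • sv r ((m : ℕ) + 1) - (1 : ℝ) • sv r ((m : ℕ) + 1)) l
        = if l = m then 1 else 0 := by
      intro m
      simp only [Pi.sub_apply, Pi.smul_apply, smul_eq_mul, sv_apply', Nat.add_right_cancel_iff,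
        Fin.val_inj]
      split_ifs <;> norm_num
    rw [Finset.sum_apply, Finset.sum_congr rfl fun m _ => this m, Finset.sum_ite_eq]
    simp [T]
  rw [hL, Pi.smul_apply, Pi.add_apply, hε]
  simp only [εL, Pi.sub_apply, sum_sv_apply, smul_eq_mul]
  by_cases h1 : (l : ℕ) < k
  · have a1 : (l : ℕ) + 1 ≤ k := h1
    have a2 : (l : ℕ) < s := by omega
    have a3 : ¬ (k + 1 ≤ (l : ℕ) + 1) := by omega
    rcases he l with h | h <;> norm_num [h, h1, a2, Nat.succ_le_iff, a3]
  · by_cases h2 : (l : ℕ) < s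
    · have a1 : k ≤ (l : ℕ) := by omega
      norm_num [hek l a1 h2, h1, h2, Nat.succ_le_iff, a1]
    · norm_num [h1, h2, Nat.succ_le_iff]
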